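/- arXiv:1803.06681 — 6 statements merged into one kernel-verified Lean document; each statement's English description precedes it below -/
import Mathlib

section
/- Let R > 0, 0 < a < 1, and let θ, q, P be real numbers with θ > 0 and 0 < q < P. Then the 3×3 real matrix S with rows (θ(P−q)/R, 0, 0), (0, (P−q)/a, θ), (0, θ, θ²(P+q)/(2q(P−q))) is symmetric and positive definite. -/
/-- The symmetrizer `S` of the transformed boundary-layer system is symmetric
and positive definite. -/
theorem symmetrizer_posDef (R a θ q P : ℝ)
    (hR : 0 < R) (ha0 : 0 < a) (ha1 : a < 1)
    (hθ : 0 < θ) (hq0 : 0 < q) (hqP : q < P)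
    (S : Matrix (Fin 3) (Fin 3) ℝ)
    (hS : S = !![θ * (P - q) / R, 0, 0;
                 0, (P - q) / a, θ;
                 0, θ, θ ^ 2 * (P + q) / (2 * q * (P - q))]) :
    S.IsSymm ∧ S.PosDef := by
  have hd : 0 < P - q := sub_pos.mpr hqP
  have hA : 0 < θ * (P - q) / R := by positivity
  have hB : 0 < (P - q) / a := by positivity
  have hQ : 0 < P + (1 - 2 * a) * q := by nlinarith
  have hE : 0 < θ ^ 2 * (P + q) / (2 * q * (P - q)) - θ ^ 2 / ((P - q) / a) := by
    have : θ ^ 2 * (P + q) / (2 * q * (P - q)) - θ ^ 2 / ((P - q) / a)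
        = θ ^ 2 * (P + (1 - 2 * a) * q) / (2 * q * (P - q)) := by
      field_simp
      ring
    rw [this]
    positivity
  generalize θ * (P - q) / R = A at *
  generalize (P - q) / a = B at *
  generalize θ ^ 2 * (P + q) / (2 * q * (P - q)) = D at *
  have hsym : S.IsSymm := by
    subst hS
    ext i j
    fin_cases i <;> fin_cases j <;> simp
  refine ⟨hsym, Matrix.PosDef.of_dotProduct_mulVec_pos ?_ ?_⟩
  · rw [Matrix.IsHermitian, Matrix.conjTranspose_eq_transpose_of_trivial]
    exact hsym
  · intro x hx
    have hform : star x ⬝ᵥ (S.mulVec x)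
        = A * x 0 ^ 2 + B * (x 1 + θ / B * x 2) ^ 2 + (D - θ ^ 2 / B) * x 2 ^ 2 := by
      subst hS
      simp [Matrix.mulVec, dotProduct, Fin.sum_univ_three]
      field_simp
      ring
    rw [hform]
    by_cases h2 : x 2 = 0
    · by_cases h1 : x 1 = 0
      · have h0 : x 0 ≠ 0 := by
          intro h0
          apply hx
          ext i
          fin_cases i <;> simp [h0, h1, h2]
        simp only [h1, h2]
        have : 0 < x 0 ^ 2 := by positivity
        simp
        positivity
      · simp only [h2]
        simp
        positivity
    · positivity
end

section
/- Let R > 0, 0 < a < 1, and let θ, q, P, u₁ be real numbers with θ > 0 and 0 < q < P; set Q := P + (1 − 2a)q. Let S be the 3×3 matrix with rows (θ(P−q)/R, 0, 0), (0, (P−q)/a, θ), (0, θ, θ²(P+q)/(2q(P−q))), and let A be the 3×3 matrix with rows (u₁, 0, −Rθ/(P−q)), (2aθq/Q, u₁, 0), (−2(P−q)q/Q, 0, u₁). Then the matrix product S·A equals the matrix with rows (θ(P−q)u₁/R, 0, −θ²), (0, (P−q)u₁/a, θu₁), (−θ², θu₁, θ²(P+q)u₁/(2q(P−q))); in particular S·A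 is symmetric. -/
/-- The product of the symmetrizer `S` with the convection matrix `A` of the
transformed boundary-layer system is the stated explicit matrix; in particular
`S * A` is symmetric. -/
theorem symmetrizer_mul_A (R a θ q P u₁ Q : ℝ)
    (hR : 0 < R) (ha0 : 0 < a) (ha1 : a < 1)
    (hθ : 0 < θ) (hq0 : 0 < q) (hqP : q < P)
    (hQ : Q = P + (1 - 2 * a) * q)
    (S A : Matrix (Fin 3) (Fin 3) ℝ)
    (hS : S = !![θ * (P - q) / R, 0, 0;
                 0, (P - q) / a, θ;
                 0, θ, θ ^ 2 * (P + q) / (2 * q * (P - q))])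
    (hA : A = !![u₁, 0, -(R * θ / (P - q));
                 2 * a * θ * q / Q, u₁, 0;
                 -(2 * (P - q) * q / Q), 0, u₁]) :
    S * A = !![θ * (P - q) * u₁ / R, 0, -θ ^ 2;
               0, (P - q) * u₁ / a, θ * u₁;
               -θ ^ 2, θ * u₁, θ ^ 2 * (P + q) * u₁ / (2 * q * (P - q))] ∧
    (S * A).IsSymm := by
  have hd : P - q ≠ 0 := (sub_pos.mpr hqP).ne'
  have hQ0 : Q ≠ 0 := by
    have : 0 < Q := by rw [hQ]; nlinarith [mul_pos (sub_pos.mpr ha1) hq0]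
    exact this.ne'
  have hR0 := hR.ne'
  have ha := ha0.ne'
  have hq := hq0.ne'
  have e12 : (P - q) / a * (2 * a * θ * q / Q) + θ * (-(2 * (P - q) * q / Q)) = 0 := by
    field_simp
    ring
  have e13 : θ * (P - q) / R * (-(R * θ / (P - q))) = -θ ^ 2 := by
    field_simp
  have e31 : θ * (2 * a * θ * q / Q)
      + θ ^ 2 * (P + q) / (2 * q * (P - q)) * (-(2 * (P - q) * q / Q)) = -θ ^ 2 := by
    field_simp
    rw [hQ]
    ring
  have key : S * A = !![θ * (P - q) * u₁ / R, 0, -θ ^ 2;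
               0, (P - q) * u₁ / a, θ * u₁;
               -θ ^ 2, θ * u₁, θ ^ 2 * (P + q) * u₁ / (2 * q * (P - q))] := by
    rw [hS, hA]
    ext i j
    fin_cases i <;> fin_cases j <;>
      simp only [Matrix.mul_apply, Fin.sum_univ_three] <;> simp [-mul_neg, -neg_mul] <;>
      first
      | linear_combination e12
      | linear_combination e13
      | linear_combination e31
      | ring
  refine ⟨key, ?_⟩
  rw [key]
  apply Matrix.IsSymm.ext
  intro i j
  fin_cases i <;> fin_cases j <;> simp
end

section
/- Let R > 0, 0 < a < 1, μ, κ, ν > 0, and let θ, q, P be real numbers with θ > 0 and 0 < q < P; set Q := P + (1 − 2a)q. Let S be the 3×3 matrix with rows (θ(P−q)/R, 0, 0), (0, (P−q)/a, θ), (0, θ, θ²(P+q)/(2q(P−q))), and let B be 2q times the 3×3 matrix with rows (μRθ/(P−q), 0, 0), (0, κaθ(P+q)/(Q(P−q)), −νaθ/Q), (0, −2κaq/Q, ν(P−q)/Q). Then S·B is the diagonal matrix diag(2μθ²q, 2κθq, νθ²), and in particular S·B is symmetric positive definite. -/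
/-- The product of the symmetrizer `S` with the diffusion matrix `B` of the
transformed boundary-layer system is the diagonal matrix
`diag(2μθ²q, 2κθq, νθ²)`; in particular `S * B` is symmetric positive
definite. -/
theorem symmetrizer_mul_B (R a μ κ ν θ q P Q : ℝ)
    (hR : 0 < R) (ha0 : 0 < a) (ha1 : a < 1)
    (hμ : 0 < μ) (hκ : 0 < κ) (hν : 0 < ν)
    (hθ : 0 < θ) (hq0 : 0 < q) (hqP : q < P)
    (hQ : Q = P + (1 - 2 * a) * q)
    (S B : Matrix (Fin 3) (Fin 3) ℝ)
    (hS : S = !![θ * (P - q) / R, 0, 0;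
                 0, (P - q) / a, θ;
                 0, θ, θ ^ 2 * (P + q) / (2 * q * (P - q))])
    (hB : B = (2 * q) • !![μ * R * θ / (P - q), 0, 0;
                           0, κ * a * θ * (P + q) / (Q * (P - q)), -(ν * a * θ / Q);
                           0, -(2 * κ * a * q / Q), ν * (P - q) / Q]) :
    S * B = Matrix.diagonal ![2 * μ * θ ^ 2 * q, 2 * κ * θ * q, ν * θ ^ 2] ∧
    (S * B).IsSymm ∧ (S * B).PosDef := by
  have hd : P - q ≠ 0 := (sub_pos.2 hqP).ne'
  have hQ0 : Q ≠ 0 := by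
    have : 0 < Q := by rw [hQ]; nlinarith [mul_pos hq0 (sub_pos.2 ha1)]
    exact this.ne'
  have hs : P + q = Q + 2 * a * q := by rw [hQ]; ring
  have key : S * B = Matrix.diagonal ![2 * μ * θ ^ 2 * q, 2 * κ * θ * q, ν * θ ^ 2] := by
    rw [hS, hB, hs]
    clear hS hB hs hQ
    ext i j
    fin_cases i <;> fin_cases j <;>
      simp [Matrix.mul_apply, Fin.sum_univ_three, Matrix.diagonal] <;> field_simp <;> ring
  refine ⟨key, ?_, ?_⟩
  · rw [key]; exact Matrix.isSymm_diagonal _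
  · rw [key, Matrix.posDef_diagonal_iff]
    intro i
    fin_cases i <;> simp <;> positivity
end

section
/- Let R > 0, 0 < a < 1, μ, κ, ν > 0, and let θ, q, P be real numbers with θ > 0 and 0 < q < P; set Q := P + (1 − 2a)q, and let p, s, w be arbitrary real numbers (standing for ∂_η u₁, ∂_η θ, ∂_η q). Let S be the 3×3 matrix with rows (θ(P−q)/R, 0, 0), (0, (P−q)/a, θ), (0, θ, θ²(P+q)/(2q(P−q))), and let F be the 3×3 matrix with rows ((ν − μRθ/(P−q))w, 0, 0), (−(2μaθq(P+q)/(Q(P−q)))p, −(κaθ(P+q)/(Q(P−q)))w, νs − (νaθ(P+q)/(Q(P−q)))w), ((4μaq²/Q)p, (2κaq/Q)w, (ν(P+q)/Q)w). Then the product S·F equals the matrix with rows ((ν(P−q)/R − μθ)θ w, 0, 0), (−2μθq p, −κθ w, (ν(P−q)/a)s), (0, 0, νθ(s + θ(P+q)/(2q(P−q)) w)). -/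
/-- Explicit form of the product `S * F` of the symmetrizer `S` with the matrix
factor `F(v, ∂_η v)` of the quadratic term, where `p, s, w` stand for
`∂_η u₁, ∂_η θ, ∂_η q`. -/
theorem symmetrizer_mul_F (R a μ κ ν θ q P Q p s w : ℝ)
    (hR : 0 < R) (ha0 : 0 < a) (ha1 : a < 1)
    (hμ : 0 < μ) (hκ : 0 < κ) (hν : 0 < ν)
    (hθ : 0 < θ) (hq0 : 0 < q) (hqP : q < P)
    (hQ : Q = P + (1 - 2 * a) * q)
    (S F : Matrix (Fin 3) (Fin 3) ℝ)
    (hS : S = !![θ * (P - q) / R, 0, 0;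
                 0, (P - q) / a, θ;
                 0, θ, θ ^ 2 * (P + q) / (2 * q * (P - q))])
    (hF : F = !![(ν - μ * R * θ / (P - q)) * w, 0, 0;
                 -(2 * μ * a * θ * q * (P + q) / (Q * (P - q))) * p,
                   -(κ * a * θ * (P + q) / (Q * (P - q))) * w,
                   ν * s - (ν * a * θ * (P + q) / (Q * (P - q))) * w;
                 (4 * μ * a * q ^ 2 / Q) * p, (2 * κ * a * q / Q) * w,
                   (ν * (P + q) / Q) * w]) :
    S * F = !![(ν * (P - q) / R - μ * θ) * θ * w, 0, 0;
               -(2 * μ * θ * q) * p, -(κ * θ) * w, (ν * (P - q) / a) * s;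
               0, 0, ν * θ * (s + θ * (P + q) / (2 * q * (P - q)) * w)] := by
  have hd : P - q ≠ 0 := (sub_pos.mpr hqP).ne'
  have hQ0 : Q ≠ 0 := by
    have : 0 < Q := by rw [hQ]; nlinarith [mul_pos hq0 (sub_pos.mpr ha1)]
    exact this.ne'
  have hR0 := hR.ne'
  have ha := ha0.ne'
  have hq := hq0.ne'
  have h21 : (P - q) / a * (-(2 * μ * a * θ * q * (P + q) / (Q * (P - q))) * p)
      + θ * ((4 * μ * a * q ^ 2 / Q) * p) = -(2 * μ * θ * q) * p := by
    field_simp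
    rw [hQ]; ring
  have h22 : (P - q) / a * (-(κ * a * θ * (P + q) / (Q * (P - q))) * w)
      + θ * ((2 * κ * a * q / Q) * w) = -(κ * θ) * w := by
    field_simp
    rw [hQ]; ring
  have h23 : (P - q) / a * (ν * s - (ν * a * θ * (P + q) / (Q * (P - q))) * w)
      + θ * ((ν * (P + q) / Q) * w) = (ν * (P - q) / a) * s := by
    field_simp
    ring
  have h31 : θ * (-(2 * μ * a * θ * q * (P + q) / (Q * (P - q))) * p)
      + θ ^ 2 * (P + q) / (2 * q * (P - q)) * ((4 * μ * a * q ^ 2 / Q) * p) = 0 := by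
    field_simp
    ring
  have h32 : θ * (-(κ * a * θ * (P + q) / (Q * (P - q))) * w)
      + θ ^ 2 * (P + q) / (2 * q * (P - q)) * ((2 * κ * a * q / Q) * w) = 0 := by
    field_simp
    ring
  have h33 : θ * (ν * s - (ν * a * θ * (P + q) / (Q * (P - q))) * w)
      + θ ^ 2 * (P + q) / (2 * q * (P - q)) * ((ν * (P + q) / Q) * w)
      = ν * θ * (s + θ * (P + q) / (2 * q * (P - q)) * w) := by
    field_simp
    rw [hQ]; ring
  have h11 : θ * (P - q) / R * ((ν - μ * R * θ / (P - q)) * w)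
      = (ν * (P - q) / R - μ * θ) * θ * w := by
    field_simp
  rw [hS, hF]
  clear hS hF
  ext i j
  fin_cases i <;> fin_cases j <;>
    simp only [Matrix.mul_apply, Fin.sum_univ_three] <;>
    simp [-neg_mul, -mul_neg, -mul_eq_mul_left_iff, -mul_eq_mul_right_iff] <;>
    first | exact h11 | exact h21 | exact h22 | exact h23 | exact h31 | exact h32 | exact h33
end

section
/- Let ν be a real number, T > 0, and let u₁, u₂, h₁, h₂ : [0,T] × ℝ × [0,∞) → ℝ be smooth functions such that on the whole domain: ∂_t h₁ + ∂_y(u₂h₁ − u₁h₂) = ν ∂_y² h₁ and ∂_x h₁ + ∂_y h₂ = 0; and on the boundary {y = 0}: u₁(t,x,0) = u₂(t,x,0) = 0, h₂(t,x,0) = 0 and ∂_y h₁(t,x,0) = 0 for all (t,x). Then the normal induction equation ∂_t h₂ − ∂_x(u₂h₁ − u₁h₂) = ν ∂_y² h₂ holds on the whole domain. -/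
open Set

/-- Partial derivative in time `t` for functions of `(t, x, y)`. -/
noncomputable def pdT (f : ℝ × ℝ × ℝ → ℝ) (p : ℝ × ℝ × ℝ) : ℝ :=
  fderiv ℝ f p (1, 0, 0)

/-- Partial derivative in the tangential variable `x`. -/
noncomputable def pdX (f : ℝ × ℝ × ℝ → ℝ) (p : ℝ × ℝ × ℝ) : ℝ :=
  fderiv ℝ f p (0, 1, 0)

/-- Partial derivative in the normal variable `y`. -/
noncomputable def pdY (f : ℝ × ℝ × ℝ → ℝ) (p : ℝ × ℝ × ℝ) : ℝ :=
  fderiv ℝ f p (0, 0, 1)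

lemma aux_smooth {f : ℝ × ℝ × ℝ → ℝ} (hf : ContDiff ℝ (⊤ : ℕ∞) f) (v : ℝ × ℝ × ℝ) :
    ContDiff ℝ (⊤ : ℕ∞) (fun p => fderiv ℝ f p v) :=
  (hf.fderiv_right (m := (⊤ : ℕ∞)) (by norm_cast)).clm_apply contDiff_const

lemma aux_diff {f : ℝ × ℝ × ℝ → ℝ} (hf : ContDiff ℝ (⊤ : ℕ∞) f) : Differentiable ℝ f :=
  hf.differentiable (by simp)

lemma aux_comm {f : ℝ × ℝ × ℝ → ℝ} (hf : ContDiff ℝ (⊤ : ℕ∞) f) (v w p : ℝ × ℝ × ℝ) :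
    fderiv ℝ (fun q => fderiv ℝ f q v) p w = fderiv ℝ (fun q => fderiv ℝ f q w) p v := by
  have hd : DifferentiableAt ℝ (fderiv ℝ f) p :=
    ((hf.fderiv_right (m := (⊤ : ℕ∞)) (by norm_cast)).differentiable (by simp)) p
  have h := (hf.contDiffAt (x := p)).isSymmSndFDerivAt (by simp; norm_cast)
  have key : ∀ a b : ℝ × ℝ × ℝ, fderiv ℝ (fun q => fderiv ℝ f q a) p b
      = fderiv ℝ (fderiv ℝ f) p b a := by
    intro a b
    rw [fderiv_clm_apply hd (by fun_prop)]
    simp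
  rw [key, key]
  exact h w v

lemma aux_closure {T : ℝ} (hT : 0 < T) {f : ℝ × ℝ × ℝ → ℝ} (hf : Continuous f)
    (h : ∀ p ∈ Ioo 0 T ×ˢ (univ : Set ℝ) ×ˢ Ioi (0:ℝ), f p = 0) :
    ∀ p ∈ Icc 0 T ×ˢ (univ : Set ℝ) ×ˢ Ici (0:ℝ), f p = 0 := by
  intro p hp
  have hc : p ∈ closure (Ioo 0 T ×ˢ (univ : Set ℝ) ×ˢ Ioi (0:ℝ)) := by
    rw [closure_prod_eq, closure_prod_eq, closure_Ioo hT.ne, closure_Ioi, closure_univ]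
    exact hp
  exact closure_minimal (t := {q | f q = 0}) h (isClosed_eq hf continuous_const) hc

lemma aux_zero {T : ℝ} (hT : 0 < T) {f : ℝ × ℝ × ℝ → ℝ} (hf : ContDiff ℝ (⊤ : ℕ∞) f)
    (h : ∀ p ∈ Icc 0 T ×ˢ (univ : Set ℝ) ×ˢ Ici (0:ℝ), f p = 0) (v : ℝ × ℝ × ℝ) :
    ∀ p ∈ Icc 0 T ×ˢ (univ : Set ℝ) ×ˢ Ici (0:ℝ), fderiv ℝ f p v = 0 := by
  refine aux_closure hT (aux_smooth hf v).continuous ?_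
  intro p hp
  have ho : IsOpen (Ioo 0 T ×ˢ (univ : Set ℝ) ×ˢ Ioi (0:ℝ)) :=
    isOpen_Ioo.prod (isOpen_univ.prod isOpen_Ioi)
  have he : f =ᶠ[nhds p] fun _ => (0:ℝ) := by
    filter_upwards [ho.mem_nhds hp] with q hq
    exact h q ⟨Ioo_subset_Icc_self hq.1, hq.2.1, Ioi_subset_Ici_self hq.2.2⟩
  rw [he.fderiv_eq]
  simp

lemma aux_bdry {T : ℝ} (hT : 0 < T) {f : ℝ × ℝ × ℝ → ℝ} (hf : ContDiff ℝ (⊤ : ℕ∞) f)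
    (h : ∀ t x : ℝ, t ∈ Icc 0 T → f (t, x, 0) = 0) (a b : ℝ) (t x : ℝ) (ht : t ∈ Icc 0 T) :
    fderiv ℝ f (t, x, 0) (a, b, 0) = 0 := by
  let π : ℝ × ℝ × ℝ →L[ℝ] ℝ × ℝ × ℝ :=
    (ContinuousLinearMap.fst ℝ ℝ (ℝ × ℝ)).prod
      (((ContinuousLinearMap.fst ℝ ℝ ℝ).comp (ContinuousLinearMap.snd ℝ ℝ (ℝ × ℝ))).prod 0)
  have h1 := aux_zero hT (f := fun p => f (π p)) (hf.comp π.contDiff)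
    (fun p hp => h p.1 p.2.1 hp.1) (a, b, 0) (t, x, 0) ⟨ht, mem_univ _, le_refl (0:ℝ)⟩
  have h2 : HasFDerivAt (fun p => f (π p)) ((fderiv ℝ f (π (t, x, 0))).comp π) (t, x, 0) :=
    (aux_diff hf (π (t, x, 0))).hasFDerivAt.comp (t, x, 0) π.hasFDerivAt
  rw [h2.fderiv] at h1
  exact h1

/-- The normal induction equation
`∂_t h₂ - ∂_x(u₂ h₁ - u₁ h₂) = ν ∂_y² h₂` is a consequence of the tangential
induction equation, the divergence-free condition, and the no-slip and
perfectly conducting boundary conditions. -/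
theorem normal_induction_equation (ν T : ℝ) (hT : 0 < T)
    (u₁ u₂ h₁ h₂ : ℝ × ℝ × ℝ → ℝ)
    (hu₁ : ContDiff ℝ (⊤ : ℕ∞) u₁) (hu₂ : ContDiff ℝ (⊤ : ℕ∞) u₂)
    (hh₁ : ContDiff ℝ (⊤ : ℕ∞) h₁) (hh₂ : ContDiff ℝ (⊤ : ℕ∞) h₂)
    (hind : ∀ t x y : ℝ, t ∈ Icc 0 T → 0 ≤ y →
      pdT h₁ (t, x, y) + pdY (fun q => u₂ q * h₁ q - u₁ q * h₂ q) (t, x, y) =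
        ν * pdY (pdY h₁) (t, x, y))
    (hdiv : ∀ t x y : ℝ, t ∈ Icc 0 T → 0 ≤ y →
      pdX h₁ (t, x, y) + pdY h₂ (t, x, y) = 0)
    (hbcu : ∀ t x : ℝ, t ∈ Icc 0 T →
      u₁ (t, x, 0) = 0 ∧ u₂ (t, x, 0) = 0)
    (hbch : ∀ t x : ℝ, t ∈ Icc 0 T →
      h₂ (t, x, 0) = 0 ∧ pdY h₁ (t, x, 0) = 0) :
    ∀ t x y : ℝ, t ∈ Icc 0 T → 0 ≤ y →
      pdT h₂ (t, x, y) - pdX (fun q => u₂ q * h₁ q - u₁ q * h₂ q) (t, x, y) =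
        ν * pdY (pdY h₂) (t, x, y) := by
  have hw : ContDiff ℝ (⊤ : ℕ∞) (fun q => u₂ q * h₁ q - u₁ q * h₂ q) :=
    (hu₂.mul hh₁).sub (hu₁.mul hh₂)
  have hw0 : ∀ t x : ℝ, t ∈ Icc 0 T →
      (fun q => u₂ q * h₁ q - u₁ q * h₂ q) (t, x, (0:ℝ)) = 0 := by
    intro t x ht
    simp [(hbcu t x ht).1, (hbcu t x ht).2]
  generalize (fun q => u₂ q * h₁ q - u₁ q * h₂ q) = w at *
  have sT : ∀ {f}, ContDiff ℝ (⊤ : ℕ∞) f → ContDiff ℝ (⊤ : ℕ∞) (pdT f) := fun hf => aux_smooth hf _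
  have sX : ∀ {f}, ContDiff ℝ (⊤ : ℕ∞) f → ContDiff ℝ (⊤ : ℕ∞) (pdX f) := fun hf => aux_smooth hf _
  have sY : ∀ {f}, ContDiff ℝ (⊤ : ℕ∞) f → ContDiff ℝ (⊤ : ℕ∞) (pdY f) := fun hf => aux_smooth hf _
  have fadd : ∀ {f g : ℝ × ℝ × ℝ → ℝ}, ContDiff ℝ (⊤ : ℕ∞) f → ContDiff ℝ (⊤ : ℕ∞) g →
      ∀ p v, fderiv ℝ (fun q => f q + g q) p v = fderiv ℝ f p v + fderiv ℝ g p v := by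
    intro f g hf hg p v
    rw [fderiv_fun_add (aux_diff hf p) (aux_diff hg p)]; rfl
  have fcomb : ∀ {f g k : ℝ × ℝ × ℝ → ℝ}, ContDiff ℝ (⊤ : ℕ∞) f → ContDiff ℝ (⊤ : ℕ∞) g →
      ContDiff ℝ (⊤ : ℕ∞) k → ∀ (c : ℝ) p v, fderiv ℝ (fun q => f q + c * g q - ν * k q) p v
        = fderiv ℝ f p v + c * fderiv ℝ g p v - ν * fderiv ℝ k p v := by
    intro f g k hf hg hk c p v
    have := (((aux_diff hf p).hasFDerivAt.add ((aux_diff hg p).hasFDerivAt.const_mul c)).sub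
      ((aux_diff hk p).hasFDerivAt.const_mul ν)).fderiv
    exact congrArg (fun L : ℝ × ℝ × ℝ →L[ℝ] ℝ => L v) this
  have cTX : pdX (pdT h₁) = pdT (pdX h₁) := funext fun p => aux_comm hh₁ _ _ p
  have cTY : pdY (pdT h₂) = pdT (pdY h₂) := funext fun p => aux_comm hh₂ _ _ p
  have cXYw : pdY (pdX w) = pdX (pdY w) := funext fun p => aux_comm hw _ _ p
  have cXY1 : pdY (pdX h₁) = pdX (pdY h₁) := funext fun p => aux_comm hh₁ _ _ p
  have cXYY : pdY (pdX (pdY h₁)) = pdX (pdY (pdY h₁)) := funext fun p => aux_comm (sY hh₁) _ _ p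
  have sD : ContDiff ℝ (⊤ : ℕ∞) (fun q => pdX h₁ q + pdY h₂ q) := (sX hh₁).add (sY hh₂)
  have D0 : ∀ p ∈ Icc 0 T ×ˢ (univ : Set ℝ) ×ˢ Ici (0:ℝ), (fun q => pdX h₁ q + pdY h₂ q) p = 0 :=
    fun p hp => hdiv p.1 p.2.1 p.2.2 hp.1 hp.2.2
  have DT := aux_zero hT sD D0 (1, 0, 0)
  have DY := aux_zero hT sD D0 (0, 0, 1)
  have DYY := aux_zero hT (aux_smooth sD (0, 0, 1)) DY (0, 0, 1)
  have eDY : (fun q => fderiv ℝ (fun q => pdX h₁ q + pdY h₂ q) q (0, 0, 1))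
      = fun q => pdY (pdX h₁) q + pdY (pdY h₂) q :=
    funext fun q => fadd (sX hh₁) (sY hh₂) q _
  rw [eDY] at DYY
  have EX := aux_zero hT (f := fun q => pdT h₁ q + 1 * pdY w q - ν * pdY (pdY h₁) q)
    (((sT hh₁).add (contDiff_const.mul (sY hw))).sub (contDiff_const.mul (sY (sY hh₁))))
    (fun p hp => by
      have := hind p.1 p.2.1 p.2.2 hp.1 hp.2.2
      simp only [Prod.mk.eta] at this
      linarith) (0, 1, 0)
  have sG : ContDiff ℝ (⊤ : ℕ∞) (fun q => pdT h₂ q + (-1) * pdX w q - ν * pdY (pdY h₂) q) :=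
    ((sT hh₂).add (contDiff_const.mul (sX hw))).sub (contDiff_const.mul (sY (sY hh₂)))
  have GY : ∀ p ∈ Icc 0 T ×ˢ (univ : Set ℝ) ×ˢ Ici (0:ℝ),
      fderiv ℝ (fun q => pdT h₂ q + (-1) * pdX w q - ν * pdY (pdY h₂) q) p (0, 0, 1) = 0 := by
    intro p hp
    have a1 := DT p hp
    have a2 := DYY p hp
    have a3 := EX p hp
    rw [fadd (sX hh₁) (sY hh₂)] at a1
    rw [fadd (sY (sX hh₁)) (sY (sY hh₂))] at a2
    rw [fcomb (sT hh₁) (sY hw) (sY (sY hh₁))] at a3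
    rw [fcomb (sT hh₂) (sX hw) (sY (sY hh₂))]
    change pdT (pdX h₁) p + pdT (pdY h₂) p = 0 at a1
    change pdY (pdY (pdX h₁)) p + pdY (pdY (pdY h₂)) p = 0 at a2
    change pdX (pdT h₁) p + 1 * pdX (pdY w) p - ν * pdX (pdY (pdY h₁)) p = 0 at a3
    change pdY (pdT h₂) p + (-1) * pdY (pdX w) p - ν * pdY (pdY (pdY h₂)) p = 0
    rw [cXY1, cXYY] at a2
    rw [cTX] at a3
    rw [cTY, cXYw]
    linear_combination a1 - a3 - ν * a2
  intro t x y ht hy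
  have b1 : pdT h₂ (t, x, 0) = 0 := aux_bdry hT hh₂ (fun t x ht => (hbch t x ht).1) 1 0 t x ht
  have b2 : pdX w (t, x, 0) = 0 := aux_bdry hT hw hw0 0 1 t x ht
  have b3 : pdX (pdY h₁) (t, x, 0) = 0 :=
    aux_bdry hT (sY hh₁) (fun t x ht => (hbch t x ht).2) 0 1 t x ht
  have b4 := DY (t, x, 0) ⟨ht, mem_univ _, le_refl (0:ℝ)⟩
  rw [fadd (sX hh₁) (sY hh₂)] at b4
  change pdY (pdX h₁) (t, x, 0) + pdY (pdY h₂) (t, x, 0) = 0 at b4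
  rw [cXY1, b3, zero_add] at b4
  generalize hG : (fun q => pdT h₂ q + (-1) * pdX w q - ν * pdY (pdY h₂) q) = G at sG GY
  have G0 : G (t, x, 0) = 0 := by rw [← hG]; simp [b1, b2, b4]
  have hline : ∀ s : ℝ, HasDerivAt (fun s : ℝ => G (t, x, s))
      (fderiv ℝ G (t, x, s) (0, 0, 1)) s := by
    intro s
    have hl : HasDerivAt (fun s : ℝ => ((t, x, s) : ℝ × ℝ × ℝ)) (0, 0, 1) s :=
      (hasDerivAt_const s t).prodMk ((hasDerivAt_const s x).prodMk (hasDerivAt_id s))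
    exact (aux_diff sG (t, x, s)).hasFDerivAt.comp_hasDerivAt s hl
  have hconst := constant_of_has_deriv_right_zero (f := fun s : ℝ => G (t, x, s)) (a := 0) (b := y)
    (fun s _ => (hline s).continuousAt.continuousWithinAt)
    (fun s hs => by
      have := hline s
      rw [GY (t, x, s) ⟨ht, mem_univ _, hs.1⟩] at this
      exact this.hasDerivWithinAt) y ⟨hy, le_refl y⟩
  have : G (t, x, y) = 0 := hconst.trans G0
  rw [← hG] at this
  linear_combination this
end

section
/- Let R > 0 and c_V > 0 be constants and set a := R/(c_V + R). Let T > 0 and let ρ, u₁, u₂, θ, h₁, h₂ : [0,T] × ℝ × [0,∞) → ℝ be continuously differentiable functions solving the two-dimensional ideal compressible MHD system with ideal-gas pressure p = Rρθ on the half-plane, namely: (i) ∂_tρ + ∂_x(ρu₁) + ∂_y(ρu₂) = 0; (ii) ρ(∂_tu₁ + u₁∂_xu₁ + u₂∂_yu₁) + ∂_x(Rρθ) + h₂(∂_xh₂ − ∂_yh₁) = 0; (iii) ρ(∂_tu₂ + u₁∂_xu₂ + u₂∂_yu₂) + ∂_y(Rρθ) − h₁(∂_xh₂ − ∂_yh₁)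 = 0; (iv) c_Vρ(∂_tθ + u₁∂_xθ + u₂∂_yθ) + Rρθ(∂_xu₁ + ∂_yu₂) = 0; (v) ∂_th₁ + ∂_y(u₂h₁ − u₁h₂) = 0; (vi) ∂_th₂ − ∂_x(u₂h₁ − u₁h₂) = 0; (vii) ∂_xh₁ + ∂_yh₂ = 0. Assume the impermeable/perfectly conducting boundary conditions u₂(t,x,0) = h₂(t,x,0) = 0 and the positivity ρ(t,x,0) > 0, θ(t,x,0) > 0 for all (t,x). Define the traces U(t,x) := u₁(t,x,0), Θ(t,x) := θ(t,x,0), H(t,x) := h₁(t,x,0), P(t,x) := Rρ(t,x,0)Θ(t,x) + H(t,x)²/2 and Q_b := P + (1 − 2a)H²/2. Then for all (t,x): U_t + U U_x − (RΘH/(P − H²/2)) H_x + (R P_x Θ/(P − H²/2)) = 0; Θ_t + U Θ_x + (aΘH²/Q_b) U_x − (a(P_t + P_x U)Θ/Q_b) = 0; and H_t + U H_x − ((P − H²/2)H/Q_b) U_x − ((1 − a)(P_t + P_x U)H/Q_b) = 0. -/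
open Set

/-- Partial derivative in `t` for trace functions of `(t, x)`. -/
noncomputable def trT (F : ℝ × ℝ → ℝ) (q : ℝ × ℝ) : ℝ := fderiv ℝ F q (1, 0)

/-- Partial derivative in `x` for trace functions of `(t, x)`. -/
noncomputable def trX (F : ℝ × ℝ → ℝ) (q : ℝ × ℝ) : ℝ := fderiv ℝ F q (0, 1)

lemma tr_aux (f : ℝ × ℝ × ℝ → ℝ) (hf : ContDiff ℝ 1 f) (F : ℝ × ℝ → ℝ)
    (hF : ∀ q : ℝ × ℝ, F q = f (q.1, q.2, 0)) (t x : ℝ) :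
    HasFDerivAt F ((fderiv ℝ f (t, x, 0)).comp
      ((ContinuousLinearMap.fst ℝ ℝ ℝ).prod ((ContinuousLinearMap.snd ℝ ℝ ℝ).prod 0))) (t, x) := by
  have h1 : HasFDerivAt (fun q : ℝ × ℝ => ((q.1, q.2, 0) : ℝ × ℝ × ℝ))
      ((ContinuousLinearMap.fst ℝ ℝ ℝ).prod ((ContinuousLinearMap.snd ℝ ℝ ℝ).prod 0)) (t, x) :=
    hasFDerivAt_fst.prodMk (hasFDerivAt_snd.prodMk (hasFDerivAt_const _ _))
  have h2 : HasFDerivAt f (fderiv ℝ f (t, x, 0)) (t, x, 0) :=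
    (hf.differentiable one_ne_zero _).hasFDerivAt
  have h3 : F = f ∘ (fun q : ℝ × ℝ => ((q.1, q.2, 0) : ℝ × ℝ × ℝ)) := funext hF
  rw [h3]
  exact HasFDerivAt.comp (t, x) h2 h1

lemma trT_aux (f : ℝ × ℝ × ℝ → ℝ) (hf : ContDiff ℝ 1 f) (F : ℝ × ℝ → ℝ)
    (hF : ∀ q : ℝ × ℝ, F q = f (q.1, q.2, 0)) (t x : ℝ) :
    trT F (t, x) = pdT f (t, x, 0) := by
  unfold trT pdT
  rw [(tr_aux f hf F hF t x).fderiv]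
  simp

lemma trX_aux (f : ℝ × ℝ × ℝ → ℝ) (hf : ContDiff ℝ 1 f) (F : ℝ × ℝ → ℝ)
    (hF : ∀ q : ℝ × ℝ, F q = f (q.1, q.2, 0)) (t x : ℝ) :
    trX F (t, x) = pdX f (t, x, 0) := by
  unfold trX pdX
  rw [(tr_aux f hf F hF t x).fderiv]
  simp

lemma fderiv_mul_aux (f g : ℝ × ℝ × ℝ → ℝ) (hf : ContDiff ℝ 1 f) (hg : ContDiff ℝ 1 g)
    (p v : ℝ × ℝ × ℝ) :
    fderiv ℝ (fun q => f q * g q) p v = f p * fderiv ℝ g p v + g p * fderiv ℝ f p v := by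
  rw [fderiv_fun_mul (hf.differentiable one_ne_zero _) (hg.differentiable one_ne_zero _)]
  simp

lemma fderiv_p_aux (R : ℝ) (f g : ℝ × ℝ × ℝ → ℝ) (hf : ContDiff ℝ 1 f) (hg : ContDiff ℝ 1 g)
    (p v : ℝ × ℝ × ℝ) :
    fderiv ℝ (fun q => R * f q * g q) p v
      = R * (f p * fderiv ℝ g p v + g p * fderiv ℝ f p v) := by
  rw [fderiv_mul_aux (fun q => R * f q) g (contDiff_const.mul hf) hg,
    fderiv_const_mul (hf.differentiable one_ne_zero _)]
  simp
  ring

lemma fderiv_P_aux (R : ℝ) (f g h : ℝ × ℝ × ℝ → ℝ) (hf : ContDiff ℝ 1 f) (hg : ContDiff ℝ 1 g)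
    (hh : ContDiff ℝ 1 h) (p v : ℝ × ℝ × ℝ) :
    fderiv ℝ (fun q => R * f q * g q + h q ^ 2 / 2) p v
      = R * (f p * fderiv ℝ g p v + g p * fderiv ℝ f p v) + h p * fderiv ℝ h p v := by
  have e : (fun q => R * f q * g q + h q ^ 2 / 2)
      = fun q => R * f q * g q + (1 / 2 * h q) * h q := by
    funext q; ring
  have c1 : ContDiff ℝ 1 (fun q => R * f q * g q) := (contDiff_const.mul hf).mul hg
  have c2 : ContDiff ℝ 1 (fun q => 1 / 2 * h q * h q) := (contDiff_const.mul hh).mul hh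
  rw [e, fderiv_fun_add (c1.differentiable one_ne_zero _) (c2.differentiable one_ne_zero _),
    ContinuousLinearMap.add_apply, fderiv_p_aux R f g hf hg, fderiv_p_aux (1 / 2) h h hh hh]
  ring

/-- The boundary traces `(U, Θ, H, P)` of a solution of the 2D ideal
compressible MHD system with impermeable/perfectly conducting boundary
conditions satisfy the closed system of evolution equations obtained by
restricting the ideal MHD equations to the boundary `{y = 0}`. -/
theorem ideal_MHD_boundary_traces (R c_V a T : ℝ)
    (hR : 0 < R) (hcV : 0 < c_V) (ha : a = R / (c_V + R)) (hT : 0 < T)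
    (ρ u₁ u₂ θ h₁ h₂ : ℝ × ℝ × ℝ → ℝ)
    (hρ : ContDiff ℝ 1 ρ) (hu₁ : ContDiff ℝ 1 u₁) (hu₂ : ContDiff ℝ 1 u₂)
    (hθ : ContDiff ℝ 1 θ) (hh₁ : ContDiff ℝ 1 h₁) (hh₂ : ContDiff ℝ 1 h₂)
    -- (i) mass conservation
    (heq1 : ∀ t x y : ℝ, t ∈ Icc 0 T → 0 ≤ y →
      pdT ρ (t, x, y) + pdX (fun q => ρ q * u₁ q) (t, x, y)
        + pdY (fun q => ρ q * u₂ q) (t, x, y) = 0)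
    -- (ii) tangential momentum
    (heq2 : ∀ t x y : ℝ, t ∈ Icc 0 T → 0 ≤ y →
      ρ (t, x, y) * (pdT u₁ (t, x, y) + u₁ (t, x, y) * pdX u₁ (t, x, y)
          + u₂ (t, x, y) * pdY u₁ (t, x, y))
        + pdX (fun q => R * ρ q * θ q) (t, x, y)
        + h₂ (t, x, y) * (pdX h₂ (t, x, y) - pdY h₁ (t, x, y)) = 0)
    -- (iii) normal momentum
    (heq3 : ∀ t x y : ℝ, t ∈ Icc 0 T → 0 ≤ y →
      ρ (t, x, y) * (pdT u₂ (t, x, y) + u₁ (t, x, y) * pdX u₂ (t, x, y)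
          + u₂ (t, x, y) * pdY u₂ (t, x, y))
        + pdY (fun q => R * ρ q * θ q) (t, x, y)
        - h₁ (t, x, y) * (pdX h₂ (t, x, y) - pdY h₁ (t, x, y)) = 0)
    -- (iv) energy
    (heq4 : ∀ t x y : ℝ, t ∈ Icc 0 T → 0 ≤ y →
      c_V * ρ (t, x, y) * (pdT θ (t, x, y) + u₁ (t, x, y) * pdX θ (t, x, y)
          + u₂ (t, x, y) * pdY θ (t, x, y))
        + R * ρ (t, x, y) * θ (t, x, y) * (pdX u₁ (t, x, y) + pdY u₂ (t, x, y)) = 0)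
    -- (v) tangential induction
    (heq5 : ∀ t x y : ℝ, t ∈ Icc 0 T → 0 ≤ y →
      pdT h₁ (t, x, y)
        + pdY (fun q => u₂ q * h₁ q - u₁ q * h₂ q) (t, x, y) = 0)
    -- (vi) normal induction
    (heq6 : ∀ t x y : ℝ, t ∈ Icc 0 T → 0 ≤ y →
      pdT h₂ (t, x, y)
        - pdX (fun q => u₂ q * h₁ q - u₁ q * h₂ q) (t, x, y) = 0)
    -- (vii) divergence-free condition
    (heq7 : ∀ t x y : ℝ, t ∈ Icc 0 T → 0 ≤ y →
      pdX h₁ (t, x, y) + pdY h₂ (t, x, y) = 0)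
    -- boundary conditions and positivity on the boundary
    (hbc : ∀ t x : ℝ, t ∈ Icc 0 T → u₂ (t, x, 0) = 0 ∧ h₂ (t, x, 0) = 0)
    (hpos : ∀ t x : ℝ, t ∈ Icc 0 T → 0 < ρ (t, x, 0) ∧ 0 < θ (t, x, 0))
    -- boundary traces
    (Utr Θtr Htr Ptr Qtr : ℝ × ℝ → ℝ)
    (hU : ∀ q : ℝ × ℝ, Utr q = u₁ (q.1, q.2, 0))
    (hΘ : ∀ q : ℝ × ℝ, Θtr q = θ (q.1, q.2, 0))
    (hH : ∀ q : ℝ × ℝ, Htr q = h₁ (q.1, q.2, 0))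
    (hP : ∀ q : ℝ × ℝ, Ptr q = R * ρ (q.1, q.2, 0) * θ (q.1, q.2, 0)
        + (h₁ (q.1, q.2, 0)) ^ 2 / 2)
    (hQ : ∀ q : ℝ × ℝ, Qtr q = Ptr q + (1 - 2 * a) * (Htr q) ^ 2 / 2) :
    ∀ t x : ℝ, t ∈ Icc 0 T →
      (trT Utr (t, x) + Utr (t, x) * trX Utr (t, x)
          - (R * Θtr (t, x) * Htr (t, x) / (Ptr (t, x) - (Htr (t, x)) ^ 2 / 2))
              * trX Htr (t, x)
          + R * trX Ptr (t, x) * Θtr (t, x)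
              / (Ptr (t, x) - (Htr (t, x)) ^ 2 / 2) = 0) ∧
      (trT Θtr (t, x) + Utr (t, x) * trX Θtr (t, x)
          + (a * Θtr (t, x) * (Htr (t, x)) ^ 2 / Qtr (t, x)) * trX Utr (t, x)
          - a * (trT Ptr (t, x) + trX Ptr (t, x) * Utr (t, x)) * Θtr (t, x)
              / Qtr (t, x) = 0) ∧
      (trT Htr (t, x) + Utr (t, x) * trX Htr (t, x)
          - ((Ptr (t, x) - (Htr (t, x)) ^ 2 / 2) * Htr (t, x) / Qtr (t, x))
              * trX Utr (t, x)
          - (1 - a) * (trT Ptr (t, x) + trX Ptr (t, x) * Utr (t, x)) * Htr (t, x)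
              / Qtr (t, x) = 0) := by
  intro t x ht
  obtain ⟨b1, b2⟩ := hbc t x ht
  obtain ⟨p1, p2⟩ := hpos t x ht
  have e1 := heq1 t x 0 ht le_rfl
  have e2 := heq2 t x 0 ht le_rfl
  have e4 := heq4 t x 0 ht le_rfl
  have e5 := heq5 t x 0 ht le_rfl
  have e7 := heq7 t x 0 ht le_rfl
  have cP : ContDiff ℝ 1 (fun q => R * ρ q * θ q + h₁ q ^ 2 / 2) :=
    ((contDiff_const.mul hρ).mul hθ).add ((hh₁.pow 2).div_const 2)
  rw [trT_aux u₁ hu₁ Utr hU, trX_aux u₁ hu₁ Utr hU, trT_aux θ hθ Θtr hΘ, trX_aux θ hθ Θtr hΘ,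
    trT_aux h₁ hh₁ Htr hH, trX_aux h₁ hh₁ Htr hH, trT_aux _ cP Ptr hP, trX_aux _ cP Ptr hP,
    hQ, hP, hU, hH, hΘ]
  have s1 : pdY (fun q => u₂ q * h₁ q - u₁ q * h₂ q) (t, x, 0)
      = h₁ (t, x, 0) * pdY u₂ (t, x, 0) - u₁ (t, x, 0) * pdY h₂ (t, x, 0) := by
    unfold pdY
    rw [fderiv_fun_sub ((hu₂.mul hh₁).differentiable one_ne_zero _)
      ((hu₁.mul hh₂).differentiable one_ne_zero _), ContinuousLinearMap.sub_apply,
      fderiv_mul_aux _ _ hu₂ hh₁, fderiv_mul_aux _ _ hu₁ hh₂, b1, b2]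
    ring
  rw [s1] at e5
  simp only [pdT, pdX, pdY, fderiv_P_aux R ρ θ h₁ hρ hθ hh₁, fderiv_p_aux R ρ θ hρ hθ,
    fderiv_mul_aux _ _ hρ hu₁, fderiv_mul_aux _ _ hρ hu₂, b1, b2] at e1 e2 e4 e5 e7 ⊢
  generalize ρ (t, x, 0) = r at *
  generalize θ (t, x, 0) = th at *
  generalize u₁ (t, x, 0) = U at *
  generalize h₁ (t, x, 0) = H at *
  generalize fderiv ℝ ρ (t, x, 0) (1, 0, 0) = rt at *
  generalize fderiv ℝ ρ (t, x, 0) (0, 1, 0) = rx at *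
  generalize fderiv ℝ θ (t, x, 0) (1, 0, 0) = tht at *
  generalize fderiv ℝ θ (t, x, 0) (0, 1, 0) = thx at *
  generalize fderiv ℝ u₁ (t, x, 0) (1, 0, 0) = Ut at *
  generalize fderiv ℝ u₁ (t, x, 0) (0, 1, 0) = Ux at *
  generalize fderiv ℝ h₁ (t, x, 0) (1, 0, 0) = Ht at *
  generalize fderiv ℝ h₁ (t, x, 0) (0, 1, 0) = Hx at *
  generalize fderiv ℝ u₂ (t, x, 0) (0, 0, 1) = vy at *
  generalize fderiv ℝ h₂ (t, x, 0) (0, 0, 1) = gy at *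
  clear hQ hP hU hH hΘ s1 cP heq1 heq2 heq3 heq4 heq5 heq6 heq7 hbc hpos
  have hp : 0 < R * r * th := by positivity
  have hc : 0 < c_V + R := by positivity
  have ha1 : a * (c_V + R) = R := by rw [ha]; field_simp
  have ha2 : 0 < 1 - a := by
    have : (1 - a) * (c_V + R) = c_V := by linear_combination -ha1
    by_contra hcon
    nlinarith
  have e4b : c_V * (tht + U * thx) + R * th * (Ux + vy) = 0 := by
    apply mul_left_cancel₀ p1.ne'
    linear_combination e4
  have e4c : (1 - a) * (tht + U * thx) + a * th * (Ux + vy) = 0 := by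
    apply mul_left_cancel₀ hc.ne'
    linear_combination e4b + (th * (Ux + vy) - (tht + U * thx)) * ha1
  have hQ : 0 < R * r * th + (1 - a) * H ^ 2 := by positivity
  have eP : R * r * th + H ^ 2 / 2 - H ^ 2 / 2 = R * r * th := by ring
  have eQ : R * r * th + H ^ 2 / 2 + (1 - 2 * a) * H ^ 2 / 2
    = R * r * th + (1 - a) * H ^ 2 := by ring
  rw [eP, eQ]
  have d1 : rt + U * rx = - r * (Ux + vy) := by linear_combination e1
  have d3 : Ht + U * Hx = - vy * H := by linear_combination e5 + U * e7
  have ert : rt = - r * (Ux + vy) - U * rx := by linear_combination d1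
  have eHt : Ht = - vy * H - U * Hx := by linear_combination d3
  have etht : tht = - a * th * (Ux + vy) / (1 - a) - U * thx := by
    field_simp
    linear_combination e4c
  have eUt : Ut = - R * (r * thx + th * rx) / r - U * Ux := by
    field_simp
    linear_combination e2
  have n1 := hp.ne'
  have n2 := hQ.ne'
  have n3 := ha2.ne'
  have n4 := p1.ne'
  have n5 := p2.ne'
  have n6 := hR.ne'
  subst ert eHt etht eUt
  clear ha
  refine ⟨?_, ?_, ?_⟩
  · field_simp
    ring
  · field_simp
    ring
  · field_simp
    ring
end
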